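/- arXiv:2410.22190 — 6 statements merged into one kernel-verified Lean document; each statement's English description precedes it below -/
import Mathlib

section
/- Fix a bounded continuous f : Ω → ℝ. The map Φ from the Banach space C(Ω, ℝ) of continuous real-valued functions on Ω (with the supremum norm) to the Banach space of bounded linear operators on C(Ω, ℝ), defined by Φ(g)(w) := L_{f+g}(w), is analytic on all of C(Ω, ℝ); its power-series expansion at g = 0 is Φ(g)(w) = Σ_{j=0}^∞ (1/j!) L_f(w · g^j). -/
open MeasureTheory Filter Topology

noncomputable section

/-- The left shift on the sequence space `ℕ → M`. -/
def shift {M : Type*} (x : ℕ → M) : ℕ → M := fun n => x (n + 1)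

/-- Prepending a symbol `a` to a sequence `x`, so that `shift (cons' a x) = x`. -/
def cons' {M : Type*} (a : M) (x : ℕ → M) : ℕ → M
  | 0 => a
  | n + 1 => x n

/-- The Ruelle operator with a priori measure `ν` and potential `f`. -/
def ruelle {M : Type*} [MeasurableSpace M] (ν : Measure M)
    (f w : (ℕ → M) → ℝ) : (ℕ → M) → ℝ :=
  fun x => ∫ a, Real.exp (f (cons' a x)) * w (cons' a x) ∂ν

/-- for fixed continuous `f`, the map `g ↦ L_{f+g}`, from `C(Ω, ℝ)`
to the bounded linear operators on `C(Ω, ℝ)`, is analytic everywhere, with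
power-series expansion `Φ(g)(w) = Σ_j (1/j!) L_f(w·g^j)` at `g = 0`. -/
theorem stmt_3 {M : Type*} [MetricSpace M] [CompactSpace M]
    [MeasurableSpace M] [BorelSpace M]
    (ν : Measure M) [IsProbabilityMeasure ν] [ν.IsOpenPosMeasure]
    (f : (ℕ → M) → ℝ) (hf : Continuous f)
    (Φ : C(ℕ → M, ℝ) → (C(ℕ → M, ℝ) →L[ℝ] C(ℕ → M, ℝ)))
    (hΦ : ∀ (g w : C(ℕ → M, ℝ)) (x : ℕ → M),
      Φ g w x = ruelle ν (fun y => f y + g y) (fun y => w y) x) :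
    (∀ g : C(ℕ → M, ℝ), AnalyticAt ℝ Φ g) ∧
      ∀ (g w : C(ℕ → M, ℝ)) (x : ℕ → M),
        HasSum
          (fun j : ℕ =>
            ((Nat.factorial j : ℝ))⁻¹ * ruelle ν f (fun y => w y * g y ^ j) x)
          (Φ g w x) := by
  have hexp : ∀ (g : C(ℕ → M, ℝ)) (y : ℕ → M), (NormedSpace.exp g) y = Real.exp (g y) := by
    intro g y
    have h := NormedSpace.map_exp (ContinuousMap.evalAlgHom ℝ ℝ y : C(ℕ → M, ℝ) →ₐ[ℝ] ℝ)
      (ContinuousEvalConst.continuous_eval_const y) g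
    rw [← Real.exp_eq_exp_ℝ] at h
    exact h
  have key : ∀ g w : C(ℕ → M, ℝ), Φ g w = Φ 0 (NormedSpace.exp g * w) := by
    intro g w
    ext x
    rw [hΦ, hΦ]
    unfold ruelle
    congr 1
    ext a
    simp only [ContinuousMap.mul_apply, hexp, ContinuousMap.zero_apply, add_zero, Real.exp_add]
    ring
  constructor
  · intro g
    have hΦ' : Φ = fun g => ((ContinuousLinearMap.compL ℝ C(ℕ → M, ℝ) C(ℕ → M, ℝ) C(ℕ → M, ℝ) (Φ 0)).comp
        (ContinuousLinearMap.mul ℝ C(ℕ → M, ℝ))) (NormedSpace.exp g) := by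
      funext g
      ext1 w
      exact key g w
    rw [hΦ']
    exact (ContinuousLinearMap.analyticAt _ _).comp (NormedSpace.exp_analytic (𝕂 := ℝ) g)
  · intro g w x
    have h1 := NormedSpace.exp_series_hasSum_exp' (𝕂 := ℝ) g
    have h2 := (h1.mul_right w).mapL (Φ 0)
    have h3 := h2.mapL (ContinuousMap.evalCLM ℝ x)
    rw [key g w]
    convert h3 using 1
    funext j
    rw [smul_mul_assoc, map_smul, map_smul, smul_eq_mul]
    congr 1
    change _ = Φ 0 (g ^ j * w) x
    rw [hΦ]
    unfold ruelle
    congr 1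
    ext a
    simp only [ContinuousMap.mul_apply, ContinuousMap.pow_apply, ContinuousMap.zero_apply, add_zero]
    ring
    rfl
end
end

section
/- Let f : Ω → ℝ be Lipschitz and normalized (L_f(1) ≡ 1), let μ_f be a Borel probability on Ω with ∫ L_f(w) dμ_f = ∫ w dμ_f for every bounded continuous w, and let g : Ω → ℝ be Lipschitz. Suppose λ : ℝ → ℝ is differentiable at 0 with λ(0) = 1, and W : ℝ → C(Ω, ℝ) is differentiable at 0 in the supremum norm with W(0) ≡ 1, and that L_{f+tg}(W(t)) = λ(t)·W(t) for all t ∈ ℝ. Then λ′(0) = ∫_Ω g dμ_f. -/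
open MeasureTheory Filter Topology

noncomputable section

/-- The metric `d(x,y) = Σ_n 2⁻ⁿ d_M(x_n, y_n)` on the sequence space `Ω = M^ℕ`. -/
def seqDist {M : Type*} [MetricSpace M] (x y : ℕ → M) : ℝ :=
  ∑' n : ℕ, (1 / 2 : ℝ) ^ n * dist (x n) (y n)

/-- A function `Ω → ℝ` is Lipschitz for the metric `seqDist`. -/
def LipschitzSeq {M : Type*} [MetricSpace M] (f : (ℕ → M) → ℝ) : Prop :=
  ∃ K : ℝ, 0 ≤ K ∧ ∀ x y, |f x - f y| ≤ K * seqDist x y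

theorem LipschitzSeq.cont {M : Type*} [MetricSpace M] [CompactSpace M]
    {g : (ℕ → M) → ℝ} (hg : LipschitzSeq g) : Continuous g := by
  obtain ⟨K, hK, h⟩ := hg
  rw [continuous_iff_continuousAt]
  intro x
  have hc : Continuous (fun y : ℕ → M => seqDist y x) := by
    unfold seqDist
    refine continuous_tsum (u := fun n : ℕ => (1 / 2 : ℝ) ^ n * Metric.diam (Set.univ : Set M))
      (fun n => by fun_prop) (summable_geometric_two.mul_right _) ?_
    intro n y
    rw [Real.norm_of_nonneg (by positivity)]
    gcongr
    exact Metric.dist_le_diam_of_mem isCompact_univ.isBounded (Set.mem_univ _) (Set.mem_univ _)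
  have h0 : seqDist x x = 0 := by simp [seqDist]
  have ht : Tendsto (fun y => K * seqDist y x) (𝓝 x) (𝓝 0) := by
    have := (hc.const_mul K).tendsto x
    simpa [h0] using this
  rw [ContinuousAt, tendsto_iff_dist_tendsto_zero]
  exact squeeze_zero (fun _ => dist_nonneg) (fun y => by rw [Real.dist_eq]; exact h y x) ht

/-- derivative of the leading eigenvalue at a normalized potential:
`λ′(0) = ∫ g dμ_f`. -/
theorem stmt_4 {M : Type*} [MetricSpace M] [CompactSpace M]
    [MeasurableSpace M] [BorelSpace M]
    (ν : Measure M) [IsProbabilityMeasure ν] [ν.IsOpenPosMeasure]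
    (f : (ℕ → M) → ℝ) (hf : LipschitzSeq f)
    (hnorm : ∀ x, ruelle ν f (fun _ => (1 : ℝ)) x = 1)
    (μ : Measure (ℕ → M)) [IsProbabilityMeasure μ]
    (hfix : ∀ w : (ℕ → M) → ℝ, Continuous w →
      ∫ x, ruelle ν f w x ∂μ = ∫ x, w x ∂μ)
    (g : (ℕ → M) → ℝ) (hg : LipschitzSeq g)
    (lam : ℝ → ℝ) (lam' : ℝ) (hlam0 : lam 0 = 1)
    (hlam : HasDerivAt lam lam' 0)
    (W : ℝ → C(ℕ → M, ℝ)) (hWdiff : DifferentiableAt ℝ W 0)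
    (hW0 : W 0 = 1)
    (heig : ∀ (t : ℝ) (x : ℕ → M),
      ruelle ν (fun y => f y + t * g y) (fun y => W t y) x = lam t * W t x) :
    lam' = ∫ x, g x ∂μ := by
  haveI : BorelSpace (ℕ → M) := inferInstance
  have hgc := hg.cont
  have hint : ∀ h : C(ℕ → M, ℝ), Integrable (fun x => h x) μ := fun h =>
    Integrable.of_bound h.continuous.aestronglyMeasurable ‖h‖
      (Eventually.of_forall fun x => h.norm_coe_le_norm x)
  let I : C(ℕ → M, ℝ) →L[ℝ] ℝ := LinearMap.mkContinuous
    { toFun := fun h => ∫ x, h x ∂μ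
      map_add' := fun a b => by simpa using integral_add (hint a) (hint b)
      map_smul' := fun c a => by simp [integral_const_mul] } 1 (by
        intro h
        have := norm_integral_le_of_norm_le_const (μ := μ) (f := fun x => h x) (C := ‖h‖)
          (Eventually.of_forall fun x => h.norm_coe_le_norm x)
        simpa using this)
  have hI : ∀ h, I h = ∫ x, h x ∂μ := fun h => rfl
  let G : C(ℕ → M, ℝ) := ⟨g, hgc⟩
  have hE : ∀ (t : ℝ) (x : ℕ → M), (NormedSpace.exp (t • G)) x = Real.exp (t * g x) := by
    intro t x
    have := NormedSpace.map_exp (ContinuousMap.evalAlgHom ℝ ℝ x)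
      (continuous_eval_const x) (t • G)
    rw [Real.exp_eq_exp_ℝ]
    exact this
  have key : ∀ t, I (NormedSpace.exp (t • G) * W t) = lam t * I (W t) := by
    intro t
    have h1 := hfix (fun y => Real.exp (t * g y) * W t y) (by fun_prop)
    have h2 : ∀ x, ruelle ν f (fun y => Real.exp (t * g y) * W t y) x = lam t * W t x := by
      intro x
      rw [← heig t x]
      simp only [ruelle, Real.exp_add, mul_assoc]
    simp only [h2, integral_const_mul] at h1
    rw [hI, hI, h1]
    simp only [ContinuousMap.mul_apply, hE]
  have hEd : HasDerivAt (fun t : ℝ => NormedSpace.exp (t • G)) G 0 := by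
    simpa using hasDerivAt_exp_smul_const (𝕂 := ℝ) G (0 : ℝ)
  have hWd := hWdiff.hasDerivAt
  have d1 := I.hasFDerivAt.comp_hasDerivAt (0 : ℝ) (hEd.mul hWd)
  have d2 := hlam.mul (I.hasFDerivAt.comp_hasDerivAt (0 : ℝ) hWd)
  have he := d1.unique (d2.congr_of_eventuallyEq (Eventually.of_forall key))
  have hI1 : I 1 = 1 := by simp [hI]
  simp [hW0, hlam0, hI1] at he
  rw [← he]
  rfl
end
end

section
/- Let f : Ω → ℝ be Lipschitz (not necessarily normalized), and suppose the Ruelle–Perron–Frobenius data for f are given: λ_f > 0, a strictly positive continuous w_f : Ω → ℝ, and a Borel probability ρ_f on Ω such that L_f(w_f) = λ_f·w_f, ∫ L_f(w) dρ_f = λ_f ∫ w dρ_f for every bounded continuous w, and ∫ w_f dρ_f = 1. Define the probability μ_f by dμ_f = w_f dρ_f. Let g : Ω → ℝ be Lipschitz, λ : ℝ → ℝ differentiable at 0 with λ(0) = λ_f, and W : ℝ → C(Ω, ℝ) differentiable at 0 in the supremum norm with W(0) = w_f, such that L_{f+tg}(W(t)) = λ(t)·W(t) for all t ∈ ℝ.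 Then λ′(0) = λ_f · ∫_Ω g dμ_f. -/
open MeasureTheory Filter Topology

noncomputable section

theorem aux_cont {M : Type*} [MetricSpace M] [CompactSpace M]
    (g : (ℕ → M) → ℝ) (hg : LipschitzSeq g) : Continuous g := by
  obtain ⟨K, hK, h⟩ := hg
  rw [continuous_iff_continuousAt]
  intro x
  have hc : Continuous (fun y : ℕ → M => seqDist y x) := by
    unfold seqDist
    refine continuous_tsum (u := fun n : ℕ => (1 / 2 : ℝ) ^ n * Metric.diam (Set.univ : Set M)) ?_ ?_ ?_
    · intro n
      fun_prop
    · exact (summable_geometric_two).mul_right _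
    · intro n y
      rw [Real.norm_of_nonneg (by positivity)]
      gcongr
      exact Metric.dist_le_diam_of_mem isCompact_univ.isBounded trivial trivial
  have h0 : seqDist x x = 0 := by simp [seqDist]
  have ht : Tendsto (fun y => K * seqDist y x) (𝓝 x) (𝓝 0) := by
    have := (hc.const_mul K).tendsto x
    simpa [h0] using this
  rw [ContinuousAt, tendsto_iff_dist_tendsto_zero]
  exact squeeze_zero (fun _ => dist_nonneg) (fun y => by rw [Real.dist_eq]; exact h y x) ht

theorem aux_int {X : Type*} [TopologicalSpace X] [CompactSpace X] [MeasurableSpace X]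
    [BorelSpace X] (ρ : Measure X) [IsProbabilityMeasure ρ] (u : C(X, ℝ)) :
    Integrable (fun x => u x) ρ :=
  u.continuous.integrable_of_hasCompactSupport (HasCompactSupport.of_compactSpace _)

/-- Integration as a continuous linear functional. -/
def auxI {X : Type*} [TopologicalSpace X] [CompactSpace X] [MeasurableSpace X]
    [BorelSpace X] (ρ : Measure X) [IsProbabilityMeasure ρ] : C(X, ℝ) →L[ℝ] ℝ :=
  LinearMap.mkContinuous
    { toFun := fun u => ∫ x, u x ∂ρ
      map_add' := fun u v => integral_add (aux_int ρ u) (aux_int ρ v)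
      map_smul' := fun c u => integral_const_mul c _ } 1 (fun u => by
        have := norm_integral_le_of_norm_le_const (μ := ρ) (f := fun x => u x)
          (Eventually.of_forall fun x => u.norm_coe_le_norm x)
        simpa using this)

theorem aux_exp {X : Type*} [TopologicalSpace X] [CompactSpace X] (u : C(X, ℝ)) (x : X) :
    (NormedSpace.exp u) x = Real.exp (u x) := by
  have := NormedSpace.map_exp (ContinuousMap.evalAlgHom ℝ ℝ x)
    (show Continuous (fun v : C(X, ℝ) => v x) from continuous_eval_const x) u
  rw [Real.exp_eq_exp_ℝ]
  exact this

/-- derivative of the leading eigenvalue at a not-necessarily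
normalized potential: `λ′(0) = λ_f ∫ g dμ_f`, where `dμ_f = w_f dρ_f`. -/
theorem stmt_5 {M : Type*} [MetricSpace M] [CompactSpace M]
    [MeasurableSpace M] [BorelSpace M]
    (ν : Measure M) [IsProbabilityMeasure ν] [ν.IsOpenPosMeasure]
    (f : (ℕ → M) → ℝ) (hf : LipschitzSeq f)
    (lamf : ℝ) (hlamf : 0 < lamf)
    (wf : (ℕ → M) → ℝ) (hwfc : Continuous wf) (hwfpos : ∀ x, 0 < wf x)
    (ρ : Measure (ℕ → M)) [IsProbabilityMeasure ρ]
    (heigf : ∀ x, ruelle ν f wf x = lamf * wf x)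
    (hdual : ∀ w : (ℕ → M) → ℝ, Continuous w →
      ∫ x, ruelle ν f w x ∂ρ = lamf * ∫ x, w x ∂ρ)
    (hwfint : ∫ x, wf x ∂ρ = 1)
    (g : (ℕ → M) → ℝ) (hg : LipschitzSeq g)
    (lam : ℝ → ℝ) (lam' : ℝ) (hlam0 : lam 0 = lamf)
    (hlam : HasDerivAt lam lam' 0)
    (W : ℝ → C(ℕ → M, ℝ)) (hWdiff : DifferentiableAt ℝ W 0)
    (hW0 : ∀ x, W 0 x = wf x)
    (heig : ∀ (t : ℝ) (x : ℕ → M),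
      ruelle ν (fun y => f y + t * g y) (fun y => W t y) x = lam t * W t x) :
    lam' = lamf * ∫ x, g x ∂(ρ.withDensity fun x => ENNReal.ofReal (wf x)) := by
  have hgc := aux_cont g hg
  let G : C(ℕ → M, ℝ) := ⟨g, hgc⟩
  obtain ⟨W', hW'⟩ : ∃ W', HasDerivAt W W' 0 := ⟨_, hWdiff.hasDerivAt⟩
  have hE : HasDerivAt (fun t : ℝ => NormedSpace.exp (t • G)) G 0 := by
    simpa using hasDerivAt_exp_smul_const (𝕂 := ℝ) G (0 : ℝ)
  have hP := (auxI ρ).hasFDerivAt.comp_hasDerivAt (0 : ℝ) (hE.mul hW')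
  have hQ := (auxI ρ).hasFDerivAt.comp_hasDerivAt (0 : ℝ) hW'
  have hkey : ∀ t : ℝ, lamf * auxI ρ (NormedSpace.exp (t • G) * W t) = lam t * auxI ρ (W t) := by
    intro t
    have h1 := hdual (fun x => (NormedSpace.exp (t • G) * W t) x) (ContinuousMap.continuous _)
    change lamf * ∫ x, (NormedSpace.exp (t • G) * W t) x ∂ρ = lam t * ∫ x, W t x ∂ρ
    rw [← h1, ← integral_const_mul]
    congr 1
    ext x
    rw [← heig t x]
    unfold ruelle
    congr 1
    ext a
    have h2 := aux_exp (t • G) (cons' a x)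
    simp only [ContinuousMap.mul_apply, h2, Real.exp_add]
    rw [mul_assoc]
    rfl
  have hL := hP.const_mul lamf
  have hR := hlam.mul hQ
  have heq : (fun t : ℝ => lamf * auxI ρ (NormedSpace.exp (t • G) * W t))
      = fun t => lam t * auxI ρ (W t) := funext hkey
  have hL' : HasDerivAt (fun t : ℝ => lamf * auxI ρ (NormedSpace.exp (t • G) * W t)) _ 0 := hL
  rw [heq] at hL'
  have hfin := hL'.unique hR
  have hw : auxI ρ (W 0) = 1 := by
    rw [← hwfint]
    exact integral_congr_ae (Eventually.of_forall hW0)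
  have hgw : ∫ x, g x ∂(ρ.withDensity fun x => ENNReal.ofReal (wf x)) = auxI ρ (G * W 0) := by
    rw [integral_withDensity_eq_integral_toReal_smul
      (by fun_prop) (Eventually.of_forall fun x => ENNReal.ofReal_lt_top)]
    refine integral_congr_ae (Eventually.of_forall fun x => ?_)
    simp only [ENNReal.toReal_ofReal (hwfpos x).le, smul_eq_mul, ContinuousMap.mul_apply, hW0]
    exact mul_comm _ _
  rw [hgw]
  simp only [zero_smul, NormedSpace.exp_zero, one_mul, map_add, Function.comp_apply, hw, hlam0,
    mul_one] at hfin
  linarith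
end
end

section
/- Let f : Ω → ℝ be Lipschitz and normalized (L_f(1) ≡ 1), let μ_f be a Borel probability on Ω with ∫ L_f(w) dμ_f = ∫ w dμ_f for every bounded continuous w, and let g : Ω → ℝ be Lipschitz with ∫_Ω g dμ_f = 0. Suppose p : ℝ → ℝ is twice differentiable at 0 with p(0) = 0, and W : ℝ → C(Ω, ℝ) is twice differentiable at 0 in the supremum norm with W(0) ≡ 1, and that L_{f+tg}(W(t)) = e^{p(t)}·W(t) for all t ∈ ℝ. Then p″(0) = ∫_Ω g² dμ_f + 2 ∫_Ω g · v dμ_f, where v := W′(0) ∈ C(Ω, ℝ) is the derivative at 0 of the eigenfunction family. -/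
open MeasureTheory Filter Topology

noncomputable section

lemma LipschitzSeq.cont_aux {M : Type*} [MetricSpace M] [CompactSpace M]
    {f : (ℕ → M) → ℝ} (hf : LipschitzSeq f) : Continuous f := by
  obtain ⟨K, hK, h⟩ := hf
  obtain ⟨C, hC⟩ : ∃ C : ℝ, ∀ a b : M, dist a b ≤ C := by
    obtain ⟨C, hC⟩ := Metric.isBounded_iff.1 (isCompact_univ (X := M)).isBounded
    exact ⟨C, fun a b => hC (Set.mem_univ a) (Set.mem_univ b)⟩
  have hs : ∀ x : ℕ → M, Continuous (fun y => seqDist y x) := by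
    intro x
    unfold seqDist
    refine continuous_tsum (u := fun n => (1/2 : ℝ)^n * C) (fun n => by fun_prop)
      (summable_geometric_two.mul_right C) ?_
    intro n y
    rw [Real.norm_of_nonneg (by positivity)]
    exact mul_le_mul_of_nonneg_left (hC _ _) (by positivity)
  rw [continuous_iff_continuousAt]
  intro x
  have h0 : seqDist x x = 0 := by simp [seqDist]
  have ht : Tendsto (fun y => K * seqDist y x) (𝓝 x) (𝓝 0) := by
    have := ((hs x).tendsto x).const_mul K
    simpa [h0] using this
  rw [ContinuousAt, tendsto_iff_dist_tendsto_zero]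
  exact squeeze_zero (fun _ => dist_nonneg) (fun y => by rw [Real.dist_eq]; exact h y x) ht

lemma exp_cm_apply {X : Type*} [TopologicalSpace X] [CompactSpace X] (G : C(X, ℝ)) (x : X) :
    (NormedSpace.exp G) x = Real.exp (G x) := by
  have := NormedSpace.map_exp (ContinuousMap.evalAlgHom ℝ ℝ x)
    (ContinuousMap.evalCLM ℝ x : C(X, ℝ) →L[ℝ] ℝ).continuous G
  rw [Real.exp_eq_exp_ℝ]
  exact this

lemma integral_clm {X : Type*} [TopologicalSpace X] [CompactSpace X] [MeasurableSpace X]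
    [BorelSpace X] (μ : Measure X) [IsProbabilityMeasure μ] :
    ∃ I : C(X, ℝ) →L[ℝ] ℝ, ∀ w, I w = ∫ x, w x ∂μ := by
  have hi : ∀ w : C(X, ℝ), Integrable (fun x => w x) μ := fun w =>
    w.continuous.integrable_of_hasCompactSupport (HasCompactSupport.of_compactSpace _)
  refine ⟨LinearMap.mkContinuous
    { toFun := fun w => ∫ x, w x ∂μ
      map_add' := fun a b => integral_add (hi a) (hi b)
      map_smul' := fun c a => integral_const_mul c _ } 1 ?_, fun w => rfl⟩
  intro w
  have := norm_integral_le_of_norm_le_const (μ := μ) (f := fun x => w x) (C := ‖w‖)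
    (Eventually.of_forall fun x => w.norm_coe_le_norm x)
  simpa using this

/-- second derivative of the pressure in terms of the derivative of
the eigenfunction family: `p″(0) = ∫ g² dμ_f + 2 ∫ g · W′(0) dμ_f`. -/
theorem stmt_6 {M : Type*} [MetricSpace M] [CompactSpace M]
    [MeasurableSpace M] [BorelSpace M]
    (ν : Measure M) [IsProbabilityMeasure ν] [ν.IsOpenPosMeasure]
    (f : (ℕ → M) → ℝ) (hf : LipschitzSeq f)
    (hnorm : ∀ x, ruelle ν f (fun _ => (1 : ℝ)) x = 1)
    (μ : Measure (ℕ → M)) [IsProbabilityMeasure μ]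
    (hfix : ∀ w : (ℕ → M) → ℝ, Continuous w →
      ∫ x, ruelle ν f w x ∂μ = ∫ x, w x ∂μ)
    (g : (ℕ → M) → ℝ) (hg : LipschitzSeq g)
    (hgmean : ∫ x, g x ∂μ = 0)
    (p : ℝ → ℝ) (p' : ℝ → ℝ) (p2 : ℝ)
    (hp0 : p 0 = 0)
    (hp' : ∀ᶠ t in 𝓝 (0 : ℝ), HasDerivAt p (p' t) t)
    (hp2 : HasDerivAt p' p2 0)
    (W : ℝ → C(ℕ → M, ℝ)) (W' : ℝ → C(ℕ → M, ℝ)) (W2 : C(ℕ → M, ℝ))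
    (hW0 : W 0 = 1)
    (hW' : ∀ᶠ t in 𝓝 (0 : ℝ), HasDerivAt W (W' t) t)
    (hW2 : HasDerivAt W' W2 0)
    (heig : ∀ (t : ℝ) (x : ℕ → M),
      ruelle ν (fun y => f y + t * g y) (fun y => W t y) x = Real.exp (p t) * W t x) :
    p2 = ∫ x, g x ^ 2 ∂μ + 2 * ∫ x, g x * W' 0 x ∂μ := by
  have hfc := hf.cont_aux
  have hgc := hg.cont_aux
  obtain ⟨I, hI⟩ := integral_clm μ
  let G : C(ℕ → M, ℝ) := ⟨g, hgc⟩
  let E : ℝ → C(ℕ → M, ℝ) := fun t => NormedSpace.exp (t • G)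
  have hE0 : E 0 = 1 := by simp [E]
  have hE : ∀ t, HasDerivAt E (E t * G) t := fun t => hasDerivAt_exp_smul_const G t
  have key : ∀ t, I (E t * W t) = Real.exp (p t) * I (W t) := by
    intro t
    rw [hI, hI, ← integral_const_mul]
    have h1 := hfix (fun x => (E t * W t) x) (E t * W t).continuous
    rw [← h1]
    refine integral_congr_ae (Eventually.of_forall fun x => ?_)
    simp only
    rw [← heig t x]
    unfold ruelle
    refine integral_congr_ae (Eventually.of_forall fun a => ?_)
    simp only [ContinuousMap.mul_apply, E, exp_cm_apply]
    rw [Real.exp_add, mul_assoc]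
    rfl
  have hA1 : ∀ᶠ t in 𝓝 (0 : ℝ), HasDerivAt (fun t => I (E t * W t))
      (I (E t * G * W t + E t * W' t)) t := by
    filter_upwards [hW'] with t ht
    exact I.hasFDerivAt.comp_hasDerivAt t ((hE t).mul ht)
  have hB1 : ∀ᶠ t in 𝓝 (0 : ℝ), HasDerivAt (fun t => I (E t * W t))
      (Real.exp (p t) * p' t * I (W t) + Real.exp (p t) * I (W' t)) t := by
    filter_upwards [hW', hp'] with t ht hpt
    have := hpt.exp.mul (I.hasFDerivAt.comp_hasDerivAt t ht)
    exact this.congr_of_eventuallyEq (Eventually.of_forall key)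
  have heq : (fun t => I (E t * G * W t + E t * W' t)) =ᶠ[𝓝 0]
      (fun t => Real.exp (p t) * p' t * I (W t) + Real.exp (p t) * I (W' t)) := by
    filter_upwards [hA1, hB1] with t h1 h2 using h1.unique h2
  have hW0' := hW'.self_of_nhds
  have hp0' := hp'.self_of_nhds
  have hA2 := I.hasFDerivAt.comp_hasDerivAt (0 : ℝ)
    ((((hE 0).mul_const G).mul hW0').add ((hE 0).mul hW2))
  have hB2 := ((hp0'.exp.mul hp2).mul (I.hasFDerivAt.comp_hasDerivAt (0 : ℝ) hW0')).add
    (hp0'.exp.mul (I.hasFDerivAt.comp_hasDerivAt (0 : ℝ) hW2))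
  have h2 := hA2.unique (hB2.congr_of_eventuallyEq heq)
  have h1 := heq.self_of_nhds
  have hI1 : I 1 = 1 := by rw [hI]; simp
  have hIG : I G = 0 := by rw [hI]; exact hgmean
  simp only [hE0, hW0, hp0, one_mul, mul_one, Real.exp_zero, map_add, hIG, hI1,
    Function.comp_apply] at h1 h2
  have hp1 : p' 0 = 0 := by linarith
  have e1 : I (G * G) = ∫ x, g x ^ 2 ∂μ := by
    rw [hI]; refine integral_congr_ae (Eventually.of_forall fun x => ?_)
    simp [G, sq]
  have e2 : I (G * W' 0) = ∫ x, g x * W' 0 x ∂μ := by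
    rw [hI]; rfl
  rw [← e1, ← e2]
  simp only [hp1, Pi.mul_apply, mul_zero, zero_mul] at h2
  linarith
end
end

section
/- (Derivative of entropy in a general direction.) Let (μ_t)_{t∈ℝ} be T-invariant Borel probability measures on Ω, and let f, g : Ω → ℝ be Lipschitz, written as f = ζ + (u − u∘T) + c and g = η + (v − v∘T), where ζ, η : Ω → ℝ are bounded continuous, u, v : Ω → ℝ are bounded continuous, and c ∈ ℝ. Let p : ℝ → ℝ be differentiable at 0 with p′(0) = ∫_Ω g dμ_0. Assume the map t ↦ ∫_Ω ζ dμ_t is differentiable at 0 with derivative ∫_Ω ζ·η dμ_0, and the map t ↦ ∫_Ω g dμ_t is continuous at 0. Then the entropy function h(t) := p(t) − ∫_Ω (f + tg) dμ_t is differentiable at 0 and h′(0) = − ∫_Ω ζ·η dμ_0. -/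
open MeasureTheory Filter Topology

noncomputable section

/-- derivative of the entropy `h(t) = p(t) − ∫ (f + tg) dμ_t` in a
general direction `g = η + coboundary`, where `f = ζ + coboundary + constant`:
`h′(0) = −∫ ζ·η dμ_0`. -/
theorem stmt_12 {M : Type*} [MetricSpace M] [CompactSpace M]
    [MeasurableSpace M] [BorelSpace M]
    (μ : ℝ → Measure (ℕ → M)) (hprob : ∀ t, IsProbabilityMeasure (μ t))
    (hinv : ∀ t, Measure.map shift (μ t) = μ t)
    (f g ζ η u v : (ℕ → M) → ℝ) (c : ℝ)
    (hfL : LipschitzSeq f) (hgL : LipschitzSeq g)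
    (hζ : Continuous ζ) (hη : Continuous η) (hu : Continuous u) (hv : Continuous v)
    (hfdec : ∀ x, f x = ζ x + (u x - u (shift x)) + c)
    (hgdec : ∀ x, g x = η x + (v x - v (shift x)))
    (p : ℝ → ℝ) (hp : HasDerivAt p (∫ x, g x ∂(μ 0)) 0)
    (hζd : HasDerivAt (fun t => ∫ x, ζ x ∂(μ t)) (∫ x, ζ x * η x ∂(μ 0)) 0)
    (hgc : ContinuousAt (fun t => ∫ x, g x ∂(μ t)) 0) :
    HasDerivAt (fun t => p t - ∫ x, (f x + t * g x) ∂(μ t))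
      (-∫ x, ζ x * η x ∂(μ 0)) 0 := by
  have hsh : Continuous (shift : (ℕ → M) → (ℕ → M)) :=
    continuous_pi fun n => continuous_apply (n + 1)
  have hint : ∀ (t : ℝ) (w : (ℕ → M) → ℝ), Continuous w → Integrable w (μ t) := by
    intro t w hw
    have := hprob t
    exact hw.integrable_of_hasCompactSupport (HasCompactSupport.of_compactSpace w)
  have hsi : ∀ (t : ℝ) (w : (ℕ → M) → ℝ), Continuous w →
      ∫ x, w (shift x) ∂(μ t) = ∫ x, w x ∂(μ t) := by
    intro t w hw
    have h := integral_map (μ := μ t) (φ := shift) hsh.measurable.aemeasurable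
      (f := w) hw.aestronglyMeasurable
    rw [hinv t] at h
    exact h.symm
  have hfc : Continuous f := by
    have : f = fun x => ζ x + (u x - u (shift x)) + c := funext hfdec
    rw [this]; fun_prop
  have hgcont : Continuous g := by
    have : g = fun x => η x + (v x - v (shift x)) := funext hgdec
    rw [this]; fun_prop
  have hf : ∀ t, ∫ x, f x ∂(μ t) = ∫ x, ζ x ∂(μ t) + c := by
    intro t
    have := hprob t
    simp_rw [hfdec]
    have h1 := hint t u hu
    have h2 := hint t (fun x => u (shift x)) (hu.comp hsh)
    have h3 := hint t ζ hζ
    have h4 : Integrable (fun x => u x - u (shift x)) (μ t) := h1.sub h2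
    have h5 : Integrable (fun x => ζ x + (u x - u (shift x))) (μ t) := h3.add h4
    rw [integral_add h5 (integrable_const c), integral_add h3 h4, integral_sub h1 h2, hsi t u hu]
    simp
  have hmain : (fun t => p t - ∫ x, (f x + t * g x) ∂(μ t)) =
      fun t => p t - ((∫ x, ζ x ∂(μ t)) + c + t * ∫ x, g x ∂(μ t)) := by
    funext t
    rw [integral_add (hint t f hfc) ((hint t g hgcont).const_mul t), hf t,
      integral_const_mul]
  have hmul : HasDerivAt (fun t : ℝ => t * ∫ x, g x ∂(μ t)) (∫ x, g x ∂(μ 0)) 0 := by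
    rw [hasDerivAt_iff_tendsto_slope]
    refine (hgc.tendsto.mono_left nhdsWithin_le_nhds).congr' ?_
    filter_upwards [self_mem_nhdsWithin] with t ht
    have ht0 : t ≠ 0 := ht
    simp only [slope_def_field]
    field_simp
    simp
  rw [hmain]
  have := hp.sub ((hζd.add_const c).add hmul)
  exact this.congr_deriv (by ring)
end
end

section
/- (Orthonormal Haar-type family for a Markov measure.) Let P = (P_{ij})_{i,j∈{0,1}} be a row-stochastic 2×2 matrix with all entries strictly positive, let π = (π₀, π₁) be its (unique) stationary probability vector (πP = π, π₀ + π₁ = 1, π₀, π₁ > 0), and let μ be the stationary Markov probability measure on Ω = {0,1}^ℕ determined by π and P, i.e. μ([ω]) = π_{ω₁} P_{ω₁ω₂} ⋯ P_{ω_{n−1}ω_n} for every finite word ω = (ω₁, …, ω_n) ∈ {0,1}^n, where [ω] := { x ∈ Ω : x₁ = ω₁, …, x_n = ω_n }. For each nonempty finite word ω with last letter ω_n, define e_ω : Ω → ℝ by e_ω := μ([ω])^{−1/2} ( √(P_{ω_n,1}/P_{ω_n,0}) · 1_{[ω0]} − √(P_{ω_n,0}/P_{ω_n,1}) · 1_{[ω1]}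 ). Then the family (e_ω), indexed by all nonempty finite words ω ∈ ⋃_{n≥1} {0,1}^n, is an orthonormal set in L²(μ): ∫_Ω e_ω² dμ = 1 for every ω, and ∫_Ω e_ω e_{ω′} dμ = 0 whenever ω ≠ ω′. -/
open MeasureTheory

noncomputable section

/-- The cylinder set determined by a finite word `ω` on the alphabet `{0,1}`:
the set of sequences whose first `ω.length` letters are the letters of `ω`. -/
def cyl (ω : List (Fin 2)) : Set (ℕ → Fin 2) :=
  {x | ∀ i : Fin ω.length, x i = ω.get i}

/-- The product `P_{ω₁ω₂} ⋯ P_{ω_{n−1}ω_n}` of the transition probabilities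
along the word `ω` (equal to `1` for words of length at most one). -/
def transProd (P : Fin 2 → Fin 2 → ℝ) : List (Fin 2) → ℝ
  | [] => 1
  | [_] => 1
  | a :: b :: rest => P a b * transProd P (b :: rest)

/-- The Haar-type function
`e_ω = μ([ω])^{−1/2} ( √(P_{ℓ1}/P_{ℓ0})·1_{[ω0]} − √(P_{ℓ0}/P_{ℓ1})·1_{[ω1]} )`,
where `ℓ` is the last letter of `ω`. -/
def haarFn (μ : Measure (ℕ → Fin 2)) (P : Fin 2 → Fin 2 → ℝ)
    (ω : List (Fin 2)) (hω : ω ≠ []) : (ℕ → Fin 2) → ℝ :=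
  fun x =>
    (Real.sqrt ((μ (cyl ω)).toReal))⁻¹ *
      (Real.sqrt (P (ω.getLast hω) 1 / P (ω.getLast hω) 0) *
          (cyl (ω ++ [0])).indicator (fun _ => (1 : ℝ)) x
        - Real.sqrt (P (ω.getLast hω) 0 / P (ω.getLast hω) 1) *
          (cyl (ω ++ [1])).indicator (fun _ => (1 : ℝ)) x)

theorem mem_cyl (ω : List (Fin 2)) (x : ℕ → Fin 2) :
    x ∈ cyl ω ↔ ∀ (i : ℕ) (h : i < ω.length), x i = ω[i] := by
  constructor
  · intro h i hi
    exact h ⟨i, hi⟩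
  · intro h i
    exact h i i.2

theorem mem_cyl_append (ω : List (Fin 2)) (a : Fin 2) (x : ℕ → Fin 2) :
    x ∈ cyl (ω ++ [a]) ↔ x ∈ cyl ω ∧ x ω.length = a := by
  simp only [mem_cyl]
  constructor
  · intro h
    refine ⟨fun i hi => ?_, ?_⟩
    · have := h i (by simp; omega)
      rw [this, List.getElem_append_left hi]
    · have := h ω.length (by simp)
      rw [this]; simp
  · rintro ⟨h1, h2⟩ i hi
    rcases Nat.lt_or_ge i ω.length with h | h
    · rw [h1 i h, List.getElem_append_left h]
    · have : i = ω.length := by simp at hi; omega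
      subst this
      rw [h2]; simp

theorem measurableSet_cyl (ω : List (Fin 2)) : MeasurableSet (cyl ω) := by
  have : cyl ω = ⋂ i : Fin ω.length, {x : ℕ → Fin 2 | x i = ω.get i} := by
    ext x; simp [cyl]
  rw [this]
  refine MeasurableSet.iInter fun i => ?_
  exact measurableSet_eq_fun (measurable_pi_apply _) measurable_const

theorem transProd_append (P : Fin 2 → Fin 2 → ℝ) (a : Fin 2) :
    ∀ (ω : List (Fin 2)) (hω : ω ≠ []),
      transProd P (ω ++ [a]) = transProd P ω * P (ω.getLast hω) a
  | [], h => absurd rfl h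
  | [b], _ => by simp [transProd]
  | b :: c :: r, _ => by
    have ih := transProd_append P a (c :: r) (by simp)
    simp only [List.cons_append] at ih
    simp only [List.cons_append, transProd]
    rw [ih, List.getLast_cons (by simp : c :: r ≠ [])]
    ring

theorem transProd_pos (P : Fin 2 → Fin 2 → ℝ) (hP : ∀ i j, 0 < P i j) :
    ∀ (ω : List (Fin 2)), 0 < transProd P ω
  | [] => by simp [transProd]
  | [b] => by simp [transProd]
  | b :: c :: r => by
    simp only [transProd]
    exact mul_pos (hP _ _) (transProd_pos P hP (c :: r))

theorem haarFn_eq_zero (μ : Measure (ℕ → Fin 2)) (P : Fin 2 → Fin 2 → ℝ)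
    (ω : List (Fin 2)) (hω : ω ≠ []) (x : ℕ → Fin 2) (hx : x ∉ cyl ω) :
    haarFn μ P ω hω x = 0 := by
  have h (a : Fin 2) : x ∉ cyl (ω ++ [a]) := fun h => hx ((mem_cyl_append _ _ _).1 h).1
  simp [haarFn, h]

theorem haarFn_const (μ : Measure (ℕ → Fin 2)) (P : Fin 2 → Fin 2 → ℝ)
    (ω ω' : List (Fin 2)) (hω : ω ≠ []) (hne : ω ≠ ω') (hl : ω.length ≤ ω'.length) :
    ∃ c, ∀ x ∈ cyl ω', haarFn μ P ω hω x = c := by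
  rcases Nat.lt_or_ge ω.length ω'.length with h | h
  · refine ⟨haarFn μ P ω hω (fun i => ω'.getD i 0), fun x hx => ?_⟩
    rw [mem_cyl] at hx
    have key (a : Fin 2) : x ∈ cyl (ω ++ [a]) ↔ (fun i => ω'.getD i 0) ∈ cyl (ω ++ [a]) := by
      simp only [mem_cyl]
      refine forall_congr' fun i => forall_congr' fun hi => ?_
      have hi' : i < ω'.length := by simp at hi; omega
      rw [hx i hi', List.getD_eq_getElem _ _ hi']
    have key2 (a : Fin 2) : (cyl (ω ++ [a])).indicator (fun _ => (1 : ℝ)) x =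
        (cyl (ω ++ [a])).indicator (fun _ => (1 : ℝ)) (fun i => ω'.getD i 0) := by
      by_cases hm : x ∈ cyl (ω ++ [a])
      · rw [Set.indicator_of_mem hm, Set.indicator_of_mem ((key a).1 hm)]
      · rw [Set.indicator_of_notMem hm, Set.indicator_of_notMem (fun h => hm ((key a).2 h))]
    unfold haarFn
    rw [key2 0, key2 1]
  · refine ⟨0, fun x hx => haarFn_eq_zero μ P ω hω x fun hx' => hne ?_⟩
    rw [mem_cyl] at hx hx'
    refine List.ext_getElem (by omega) fun i h1 h2 => ?_
    rw [← hx i h2, ← hx' i h1]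

theorem integrable_ind (μ : Measure (ℕ → Fin 2)) [IsProbabilityMeasure μ] (ω : List (Fin 2)) :
    Integrable ((cyl ω).indicator (fun _ => (1 : ℝ))) μ :=
  (integrable_const 1).indicator (measurableSet_cyl ω)

theorem integral_ind (μ : Measure (ℕ → Fin 2)) [IsProbabilityMeasure μ] (ω : List (Fin 2)) :
    ∫ x, (cyl ω).indicator (fun _ => (1 : ℝ)) x ∂μ = (μ (cyl ω)).toReal := by
  rw [integral_indicator (measurableSet_cyl ω)]
  simp [Measure.real]

theorem integral_comb (μ : Measure (ℕ → Fin 2)) [IsProbabilityMeasure μ] (ω ω' : List (Fin 2))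
    (a b : ℝ) :
    ∫ x, (a * (cyl ω).indicator (fun _ => (1 : ℝ)) x +
      b * (cyl ω').indicator (fun _ => (1 : ℝ)) x) ∂μ =
    a * (μ (cyl ω)).toReal + b * (μ (cyl ω')).toReal := by
  rw [integral_add ((integrable_ind μ ω).const_mul a) ((integrable_ind μ ω').const_mul b),
    integral_const_mul, integral_const_mul, integral_ind, integral_ind]

theorem integral_haar (μ : Measure (ℕ → Fin 2)) [IsProbabilityMeasure μ]
    (P : Fin 2 → Fin 2 → ℝ) (hPpos : ∀ i j, 0 < P i j)
    (ω : List (Fin 2)) (hω : ω ≠ [])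
    (hs : ∀ a, (μ (cyl (ω ++ [a]))).toReal = (μ (cyl ω)).toReal * P (ω.getLast hω) a) :
    ∫ x, haarFn μ P ω hω x ∂μ = 0 := by
  simp only [haarFn]
  rw [integral_const_mul]
  simp only [sub_eq_add_neg, ← neg_mul]
  rw [integral_comb, hs, hs]
  have h0 := hPpos (ω.getLast hω) 0
  have h1 := hPpos (ω.getLast hω) 1
  generalize P (ω.getLast hω) 0 = p at *
  generalize P (ω.getLast hω) 1 = q at *
  rw [Real.sqrt_div h1.le, Real.sqrt_div h0.le]
  have e0 := Real.mul_self_sqrt h0.le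
  have e1 := Real.mul_self_sqrt h1.le
  have g0 := Real.sqrt_pos.2 h0
  have g1 := Real.sqrt_pos.2 h1
  have : √q / √p * p = √p / √q * q := by
    nth_rewrite 2 [← e0]
    nth_rewrite 3 [← e1]
    field_simp
  linear_combination (√(μ (cyl ω)).toReal)⁻¹ * (μ (cyl ω)).toReal * this

theorem integral_haar_sq (μ : Measure (ℕ → Fin 2)) [IsProbabilityMeasure μ]
    (P : Fin 2 → Fin 2 → ℝ) (hPpos : ∀ i j, 0 < P i j) (hProw : ∀ i, P i 0 + P i 1 = 1)
    (ω : List (Fin 2)) (hω : ω ≠ []) (hm : 0 < (μ (cyl ω)).toReal)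
    (hs : ∀ a, (μ (cyl (ω ++ [a]))).toReal = (μ (cyl ω)).toReal * P (ω.getLast hω) a) :
    ∫ x, haarFn μ P ω hω x ^ 2 ∂μ = 1 := by
  have h0 := hPpos (ω.getLast hω) 0
  have h1 := hPpos (ω.getLast hω) 1
  have hr := hProw (ω.getLast hω)
  have key : ∀ x, haarFn μ P ω hω x ^ 2 = ((μ (cyl ω)).toReal)⁻¹ *
      ((P (ω.getLast hω) 1 / P (ω.getLast hω) 0) *
          (cyl (ω ++ [0])).indicator (fun _ => (1 : ℝ)) x
        + (P (ω.getLast hω) 0 / P (ω.getLast hω) 1) *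
          (cyl (ω ++ [1])).indicator (fun _ => (1 : ℝ)) x) := by
    intro x
    have d : x ∈ cyl (ω ++ [0]) → x ∉ cyl (ω ++ [1]) := by
      simp only [mem_cyl_append]
      rintro ⟨_, h⟩ ⟨_, h'⟩
      rw [h] at h'
      exact absurd h' (by decide)
    simp only [haarFn, mul_pow, inv_pow, Real.sq_sqrt hm.le]
    congr 1
    by_cases hx : x ∈ cyl (ω ++ [0])
    · simp [hx, d hx, Real.sq_sqrt (div_pos h1 h0).le]
    · by_cases hx' : x ∈ cyl (ω ++ [1])
      · simp [hx, hx', Real.sq_sqrt (div_pos h0 h1).le]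
      · simp [hx, hx']
  simp only [key]
  rw [integral_const_mul, integral_comb, hs, hs]
  generalize P (ω.getLast hω) 0 = p at *
  generalize P (ω.getLast hω) 1 = q at *
  field_simp
  linarith

/-- for the stationary Markov measure `μ` of a strictly positive
row-stochastic matrix `P` with stationary vector `π`, the family `(e_ω)` indexed
by nonempty finite words is orthonormal in `L²(μ)`. -/
theorem stmt_17
    (P : Fin 2 → Fin 2 → ℝ) (hPpos : ∀ i j, 0 < P i j)
    (hProw : ∀ i, P i 0 + P i 1 = 1)
    (π : Fin 2 → ℝ) (hπpos : ∀ i, 0 < π i) (hπsum : π 0 + π 1 = 1)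
    (hπstat : ∀ j, π j = π 0 * P 0 j + π 1 * P 1 j)
    (μ : Measure (ℕ → Fin 2)) [IsProbabilityMeasure μ]
    (hμ : ∀ (ω : List (Fin 2)) (hω : ω ≠ []),
      (μ (cyl ω)).toReal = π (ω.head hω) * transProd P ω) :
    (∀ (ω : List (Fin 2)) (hω : ω ≠ []),
      ∫ x, haarFn μ P ω hω x ^ 2 ∂μ = 1) ∧
    (∀ (ω ω' : List (Fin 2)) (hω : ω ≠ []) (hω' : ω' ≠ []), ω ≠ ω' →
      ∫ x, haarFn μ P ω hω x * haarFn μ P ω' hω' x ∂μ = 0) := by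
  have hs : ∀ (ω : List (Fin 2)) (hω : ω ≠ []) (a : Fin 2),
      (μ (cyl (ω ++ [a]))).toReal = (μ (cyl ω)).toReal * P (ω.getLast hω) a := by
    intro ω hω a
    rw [hμ _ (by simp), hμ _ hω, transProd_append P a ω hω, List.head_append_of_ne_nil hω]
    ring
  have hm : ∀ (ω : List (Fin 2)) (hω : ω ≠ []), 0 < (μ (cyl ω)).toReal := by
    intro ω hω
    rw [hμ _ hω]
    exact mul_pos (hπpos _) (transProd_pos P hPpos ω)
  have main : ∀ (ω ω' : List (Fin 2)) (hω : ω ≠ []) (hω' : ω' ≠ []), ω ≠ ω' →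
      ω.length ≤ ω'.length → ∫ x, haarFn μ P ω hω x * haarFn μ P ω' hω' x ∂μ = 0 := by
    intro ω ω' hω hω' hne hl
    obtain ⟨c, hc⟩ := haarFn_const μ P ω ω' hω hne hl
    have : ∀ x, haarFn μ P ω hω x * haarFn μ P ω' hω' x = c * haarFn μ P ω' hω' x := by
      intro x
      by_cases hx : x ∈ cyl ω'
      · rw [hc x hx]
      · rw [haarFn_eq_zero μ P ω' hω' x hx]; simp
    simp only [this]
    rw [integral_const_mul, integral_haar μ P hPpos ω' hω' (hs ω' hω'), mul_zero]
  refine ⟨fun ω hω => integral_haar_sq μ P hPpos hProw ω hω (hm ω hω) (hs ω hω), ?_⟩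
  intro ω ω' hω hω' hne
  rcases le_total ω.length ω'.length with h | h
  · exact main ω ω' hω hω' hne h
  · simp only [mul_comm (haarFn μ P ω hω _)]
    exact main ω' ω hω' hω hne.symm h
end
end
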